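/- Let z ∈ ℂ with Im z > 0, set τ := −iz and q := e(z), and let (α,β) ∈ (−1,1)² with (α,β) ≠ (0,0) and w := α + βz. Then ζ_W(w | 1,z) = (π²/3)·E₂(z)·w + δ(β)·π·cot(πα) − sgn(β)·πi − 2πi·( 𝒮₀(β,0;0,α;q) − 𝒮₀(−β,0;0,−α;q) ), where sgn(β) ∈ {−1,0,1} is the sign of β, δ(β) = 1 if β = 0 and 0 otherwise (and when β = 0 one has α ≠ 0, so cot(πα) is defined). -/

import Mathlib

noncomputable section

open Complex MeasureTheory
open scoped Real Classical

/-- `e(s) = exp(2 π i s)`. -/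
def ee (s : ℂ) : ℂ := Complex.exp (2 * (Real.pi : ℂ) * Complex.I * s)

/-- `δ(x) = 1` if `x ∈ ℤ`, `0` otherwise. -/
def dInt (x : ℝ) : ℂ := if ∃ n : ℤ, (n : ℝ) = x then 1 else 0

/-- The Lerch zeta function `ψ(r,γ,κ) = Σ_{k ∈ ℤ, γ+k>0} e((γ+k)κ) (γ+k)^{-r}`
(a convergent series when `Re r > 1`). -/
def psiL (r : ℂ) (γ κ : ℝ) : ℂ :=
  ∑' k : {k : ℤ // 0 < γ + (k : ℝ)},
    ee ((((γ + (k.1 : ℝ)) * κ : ℝ)) : ℂ) * (((γ + (k.1 : ℝ)) : ℝ) : ℂ) ^ (-r)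

/-- The `q`-series `𝒮_r(γ,δ;κ,λ;q)`, where `q = e^{-2πt}` with `Re t > 0`, and the power
`q^{(γ+k)(δ+l)}` is interpreted as `exp (-2πt(γ+k)(δ+l))`. -/
def Scal (r : ℂ) (γ δ' κ lam : ℝ) (t : ℂ) : ℂ :=
  ∑' (k : {k : ℤ // 0 < γ + (k : ℝ)}) (l : {l : ℤ // 0 < δ' + (l : ℝ)}),
    ee ((((γ + (k.1 : ℝ)) * κ + (δ' + (l.1 : ℝ)) * lam : ℝ)) : ℂ) *
      (((δ' + (l.1 : ℝ)) : ℝ) : ℂ) ^ (-r) *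
      Complex.exp (-2 * (Real.pi : ℂ) * t * ((γ + (k.1 : ℝ) : ℝ) : ℂ) * ((δ' + (l.1 : ℝ) : ℝ) : ℂ))

/-- The generalized Eisenstein series `F_{ℤ²}(s;α,β;μ,ν;z)` (mean of the two branch
conventions), defined by an absolutely convergent series for `Re s > 2`. -/
def Fz2 (s : ℂ) (α β μ ν : ℝ) (z : ℂ) : ℂ :=
  (∑' p : {p : ℤ × ℤ // β + (p.2 : ℝ) ≠ 0},
      ee ((((α + (p.1.1 : ℝ)) * μ + (β + (p.1.2 : ℝ)) * ν : ℝ)) : ℂ) *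
        ((((α + (p.1.1 : ℝ)) : ℝ) : ℂ) + (((β + (p.1.2 : ℝ)) : ℝ) : ℂ) * z) ^ (-s)) +
  dInt β *
    ((∑' m : {m : ℤ // 0 < α + (m : ℝ)},
        ee ((((α + (m.1 : ℝ)) * μ : ℝ)) : ℂ) * (((α + (m.1 : ℝ)) : ℝ) : ℂ) ^ (-s)) +
      Complex.cos ((Real.pi : ℂ) * s) *
        ∑' m : {m : ℤ // α + (m : ℝ) < 0},
          ee ((((α + (m.1 : ℝ)) * μ : ℝ)) : ℂ) * ((|α + (m.1 : ℝ)| : ℝ) : ℂ) ^ (-s))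

/-- `𝒜(s,α,μ) = cos(πs) ψ(s,-α,-μ) + ψ(s,α,μ)`. -/
def Acal (s : ℂ) (α μ : ℝ) : ℂ :=
  Complex.cos ((Real.pi : ℂ) * s) * psiL s (-α) (-μ) + psiL s α μ

/-- `ψ(k,γ,κ)` at an integer `k`: the convergent series for `k ≥ 2`, the value
`-𝒞_{1-k}(⟨γ⟩,κ)/(1-k) - δ_{k0} δ(γ)` of the analytic continuation for `k ≤ 0`,
and the (irrelevant) value `0` for `k = 1`; here `C` is the family of Taylor
coefficients `𝒞`. -/
def psiIntC (C : ℕ → ℂ → ℝ → ℂ) (k : ℤ) (γ κ : ℝ) : ℂ :=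
  if 2 ≤ k then
    ∑' n : {n : ℤ // 0 < γ + (n : ℝ)},
      ee ((((γ + (n.1 : ℝ)) * κ : ℝ)) : ℂ) * (((γ + (n.1 : ℝ)) : ℝ) : ℂ) ^ (-k)
  else if k ≤ 0 then
    -C (1 - k).toNat ((Int.fract γ : ℝ) : ℂ) κ / ((1 : ℂ) - (k : ℂ)) -
      (if k = 0 then dInt γ else 0)
  else 0

/-- The Bernoulli polynomial `B_j(x)` evaluated in `ℂ`. -/
def BpolyC (j : ℕ) (x : ℂ) : ℂ := Polynomial.aeval x (Polynomial.bernoulli j)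

/-- Weierstrass `℘`-function with periods `(1, z)`. -/
def wpFn (z w : ℂ) : ℂ :=
  w ^ (-2 : ℤ) + ∑' p : {p : ℤ × ℤ // p ≠ (0, 0)},
    ((w - (p.1.1 : ℂ) - (p.1.2 : ℂ) * z) ^ (-2 : ℤ) -
      ((p.1.1 : ℂ) + (p.1.2 : ℂ) * z) ^ (-2 : ℤ))

/-- Weierstrass zeta function with periods `(1, z)`. -/
def wzetaFn (z w : ℂ) : ℂ :=
  1 / w + ∑' p : {p : ℤ × ℤ // p ≠ (0, 0)},
    (1 / (w - (p.1.1 : ℂ) - (p.1.2 : ℂ) * z) + 1 / ((p.1.1 : ℂ) + (p.1.2 : ℂ) * z) +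
      w / ((p.1.1 : ℂ) + (p.1.2 : ℂ) * z) ^ 2)

/-- Weierstrass sigma function with periods `(1, z)`. -/
def wsigmaFn (z w : ℂ) : ℂ :=
  w * ∏' p : {p : ℤ × ℤ // p ≠ (0, 0)},
    ((1 - w / ((p.1.1 : ℂ) + (p.1.2 : ℂ) * z)) *
      Complex.exp (w / ((p.1.1 : ℂ) + (p.1.2 : ℂ) * z) +
        w ^ 2 / (2 * ((p.1.1 : ℂ) + (p.1.2 : ℂ) * z) ^ 2)))

/-- The `q`-Pochhammer symbol `(Z;q)_∞`. -/
def qPoch (Z q : ℂ) : ℂ := ∏' l : ℕ, (1 - Z * q ^ l)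

/-- `⟨x⟩' = 1 - ⟨-x⟩`. -/
def fracP (x : ℝ) : ℝ := 1 - Int.fract (-x)

/-- The Eisenstein series `E₂`. -/
def E2cl (z : ℂ) : ℂ := 1 - 24 * ∑' l : ℕ+, (l : ℂ) * ee z ^ (l : ℕ) / (1 - ee z ^ (l : ℕ))

/-- `a_{2k}`: `ζ(1-2k)` for `k ≠ 0` and `2ζ'(0) = -log 2π` for `k = 0`. -/
def acoef (k : ℤ) : ℂ :=
  if k = 0 then -(Real.log (2 * Real.pi) : ℂ) else riemannZeta ((1 - 2 * k : ℤ) : ℂ)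

/-- The classical Eisenstein series `E_{2k}`. -/
def Ecl (k : ℤ) (z : ℂ) : ℂ :=
  1 + (2 / acoef k) * ∑' l : ℕ+, (l : ℂ) ^ (2 * k - 1) * ee z ^ (l : ℕ) / (1 - ee z ^ (l : ℕ))

/-- The bilateral Lerch zeta function `ψ_ℤ^ε(r,γ,κ) = e^{-επir} ψ(r,-γ,-κ) + ψ(r,γ,κ)`. -/
def psiZpm (ε : ℤ) (r : ℂ) (γ κ : ℝ) : ℂ :=
  Complex.exp (-(ε : ℂ) * (Real.pi : ℂ) * Complex.I * r) * psiL r (-γ) (-κ) + psiL r γ κ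

/-- The general term of the series for Weierstrass' zeta function. At `m = n = 0` it equals `1 / w`,
as division by zero gives zero. -/
def wzetaTerm (z w : ℂ) (m n : ℤ) : ℂ :=
  1 / (w - m - n * z) + 1 / (m + n * z) + w / (m + n * z) ^ 2

/-- The sum `Σ_{l ≥ 1} e(lx)` for `x` in the upper half plane. -/
def eeGeom (x : ℂ) : ℂ := ee x / (1 - ee x)

lemma norm_wzetaTerm_le {w l : ℂ} (hl : l ≠ 0) (h : 2 * ‖w‖ ≤ ‖l‖) :
    ‖1 / (w - l) + 1 / l + w / l ^ 2‖ ≤ 2 * ‖w‖ ^ 2 * (‖l‖ ^ 3)⁻¹ := by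
  have hl' : 0 < ‖l‖ := norm_pos_iff.mpr hl
  have h1 : ‖l‖ / 2 ≤ ‖w - l‖ := by
    have := norm_sub_norm_le l w
    rw [norm_sub_rev] at this
    linarith
  have h2 : w - l ≠ 0 := norm_pos_iff.mp (by linarith)
  have h3 : 1 / (w - l) + 1 / l + w / l ^ 2 = w ^ 2 / (l ^ 2 * (w - l)) := by
    field_simp
    ring
  rw [h3, norm_div, norm_mul, norm_pow, norm_pow, div_le_iff₀ (by positivity)]
  have h4 : ‖l‖ ^ 3 ≤ 2 * (‖l‖ ^ 2 * ‖w - l‖) := by nlinarith [sq_nonneg ‖l‖]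
  calc ‖w‖ ^ 2 = ‖w‖ ^ 2 * (‖l‖ ^ 3)⁻¹ * ‖l‖ ^ 3 := by field_simp
    _ ≤ ‖w‖ ^ 2 * (‖l‖ ^ 3)⁻¹ * (2 * (‖l‖ ^ 2 * ‖w - l‖)) := by gcongr
    _ = _ := by ring

lemma summable_wzetaTerm {z : ℂ} (hz : 0 < z.im) (w : ℂ) :
    Summable fun p : ℤ × ℤ ↦ wzetaTerm z w p.2 p.1 := by
  let τ : UpperHalfPlane := ⟨z, hz⟩
  have key : Summable fun x : Fin 2 → ℤ ↦ wzetaTerm z w (x 1) (x 0) := by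
    have hr := EisensteinSeries.r_pos τ
    refine EisensteinSeries.summable_of_isBigO_rpow_norm (a := 3) (by norm_num) ?_
    refine Asymptotics.IsBigO.of_bound (2 * ‖w‖ ^ 2 * (EisensteinSeries.r τ ^ 3)⁻¹) ?_
    have ht : Filter.Tendsto (fun x : Fin 2 → ℤ ↦ ‖x‖) Filter.cofinite Filter.atTop := by
      rw [← Filter.cocompact_eq_cofinite]
      exact tendsto_norm_cocompact_atTop
    filter_upwards [ht.eventually_gt_atTop (2 * ‖w‖ / EisensteinSeries.r τ)] with x hx
    have hx0 : 0 < ‖x‖ := lt_of_le_of_lt (by positivity) hx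
    have hb := EisensteinSeries.r_mul_max_le τ (norm_pos_iff.mp hx0)
    rw [div_lt_iff₀ hr] at hx
    have hl : 0 < ‖(x 0 : ℂ) * (τ : ℂ) + x 1‖ := lt_of_lt_of_le (by positivity) hb
    have hτ : (x 0 : ℂ) * (τ : ℂ) + x 1 = (x 1 : ℂ) + x 0 * z := add_comm _ _
    rw [hτ] at hb hl
    have := norm_wzetaTerm_le (w := w) (norm_pos_iff.mp hl) (by linarith)
    rw [wzetaTerm, sub_sub]
    refine this.trans ?_
    rw [Real.norm_of_nonneg (by positivity), mul_assoc (2 * ‖w‖ ^ 2), ← mul_inv]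
    have h3 : ‖x‖ ^ (3 : ℝ) = ‖x‖ ^ 3 := by norm_cast
    rw [h3, ← mul_pow]
    gcongr
  have := (finTwoArrowEquiv ℤ).symm.summable_iff.mpr key
  exact this.congr fun p ↦ by simp

lemma wzetaFn_eq_tsum {z : ℂ} (hz : 0 < z.im) (w : ℂ) :
    wzetaFn z w = ∑' n : ℤ, ∑' m : ℤ, wzetaTerm z w m n := by
  have hs := summable_wzetaTerm hz w
  rw [← hs.tsum_prod (f := fun p : ℤ × ℤ ↦ wzetaTerm z w p.2 p.1),
    ← (Equiv.prodComm ℤ ℤ).tsum_eq, wzetaFn]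
  have hs' : Summable fun p : ℤ × ℤ ↦ wzetaTerm z w p.1 p.2 :=
    ((Equiv.prodComm ℤ ℤ).summable_iff.mpr hs).congr fun p ↦ by simp
  simp only [Equiv.prodComm_apply, Prod.fst_swap, Prod.snd_swap]
  rw [hs'.tsum_eq_add_tsum_ite (0, 0)]
  congr 1
  · simp [wzetaTerm]
  · have := tsum_subtype {p : ℤ × ℤ | p ≠ (0, 0)} fun p ↦ wzetaTerm z w p.1 p.2
    refine this.trans (tsum_congr fun p ↦ ?_)
    by_cases hp : p = (0, 0) <;> simp [hp]

lemma tsum_int_eq_zero_add_tsum_pnat_add {f : ℤ → ℂ} (hf : Summable f) :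
    ∑' n : ℤ, f n = f 0 + ∑' n : ℕ+, (f n + f (-n)) := by
  have hi : Function.Injective fun n : ℕ+ ↦ ((n : ℕ) : ℤ) :=
    Nat.cast_injective.comp PNat.coe_injective
  rw [tsum_int_eq_zero_add_tsum_pnat hf, add_assoc, ← Summable.tsum_add]
  · exact hf.comp_injective hi
  · exact hf.comp_injective (neg_injective.comp hi)

lemma summable_pnat_cot {x : ℂ} (hx : x ∈ Complex.integerComplement) :
    Summable fun n : ℕ+ ↦ 1 / (x - n) + 1 / (x + n) := by
  have := summable_cotTerm hx
  have h2 := summable_pnat_iff_summable_succ (f := fun n : ℕ ↦ 1 / (x - n) + 1 / (x + n))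
  rw [h2]
  exact this.congr fun n ↦ by simp [cotTerm]

lemma mem_integerComplement_of_im_ne_zero {x : ℂ} (hx : x.im ≠ 0) :
    x ∈ Complex.integerComplement := by
  rintro ⟨n, rfl⟩
  simp at hx

lemma summable_int_one_div_add_sq (y : ℂ) : Summable fun m : ℤ ↦ 1 / (y + m) ^ 2 :=
  (EisensteinSeries.linear_right_summable y 1 (k := 2) le_rfl).congr fun m ↦ by
    rw [one_div, Int.cast_one, one_mul, zpow_ofNat]

lemma tsum_wzetaTerm_zero {z : ℂ} (hz : 0 < z.im) {w : ℂ} (hw : w ∈ Complex.integerComplement) :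
    ∑' m : ℤ, wzetaTerm z w m 0 = π * cot (π * w) + π ^ 2 / 3 * w := by
  have hs : Summable fun m : ℤ ↦ wzetaTerm z w m 0 := (summable_wzetaTerm hz w).prod_factor 0
  have h2 : HasSum (fun n : ℕ+ ↦ (1 : ℂ) / (n : ℂ) ^ 2) (π ^ 2 / 6) := by
    have := hasSum_pnat_iff (f := fun n : ℕ ↦ (1 : ℂ) / (n : ℂ) ^ 2) (a := (π : ℂ) ^ 2 / 6)
    rw [this]
    have h := Complex.hasSum_ofReal.mpr hasSum_zeta_two
    simpa using h
  have hc := summable_pnat_cot hw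
  rw [tsum_int_eq_zero_add_tsum_pnat_add hs, cot_series_rep hw, add_assoc]
  congr 1
  · simp [wzetaTerm]
  · rw [show (π : ℂ) ^ 2 / 3 * w = 2 * w * (π ^ 2 / 6) by ring, ← h2.tsum_eq, ← tsum_mul_left,
      ← hc.tsum_add (h2.summable.mul_left _)]
    refine tsum_congr fun n ↦ ?_
    have hn : ((n : ℕ) : ℂ) ≠ 0 := by exact_mod_cast n.ne_zero
    simp only [wzetaTerm, Int.cast_zero, zero_mul, add_zero, sub_zero, Int.cast_neg,
      Int.cast_natCast, sub_neg_eq_add, neg_sq]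
    rw [one_div_neg_eq_neg_one_div]
    ring

lemma tsum_wzetaTerm_of_ne_zero {z : ℂ} (hz : 0 < z.im) {w : ℂ} {n : ℤ} (hn : n ≠ 0)
    (hw : w - n * z ∈ Complex.integerComplement) :
    ∑' m : ℤ, wzetaTerm z w m n =
      π * cot (π * (w - n * z)) + π * cot (π * (n * z)) + w * ∑' m : ℤ, 1 / (n * z + m) ^ 2 := by
  have hs : Summable fun m : ℤ ↦ wzetaTerm z w m n := (summable_wzetaTerm hz w).prod_factor n
  have hy : (n : ℂ) * z ∈ Complex.integerComplement :=
    mem_integerComplement_of_im_ne_zero (by simp [hn, hz.ne'])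
  have hP := (summable_int_one_div_add_sq (n * z)).mul_left w
  have hd : Summable fun m : ℤ ↦ wzetaTerm z w m n - w * (1 / (n * z + m) ^ 2) := hs.sub hP
  have : ∑' m : ℤ, wzetaTerm z w m n =
      ∑' m : ℤ, (wzetaTerm z w m n - w * (1 / (n * z + m) ^ 2)) +
        w * ∑' m : ℤ, 1 / (n * z + m) ^ 2 := by
    rw [← tsum_mul_left, ← hd.tsum_add hP]
    simp
  rw [this]
  congr 1
  rw [tsum_int_eq_zero_add_tsum_pnat_add hd, cot_series_rep hw, cot_series_rep hy,
    add_add_add_comm, ← (summable_pnat_cot hw).tsum_add (summable_pnat_cot hy)]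
  congr 1
  · simp [wzetaTerm]
    ring
  · refine tsum_congr fun m ↦ ?_
    simp only [wzetaTerm, Int.cast_neg, Int.cast_natCast]
    ring

lemma norm_ee (x : ℂ) : ‖ee x‖ = Real.exp (-2 * π * x.im) := by
  rw [ee, Complex.norm_exp]
  simp

lemma norm_ee_lt_one {x : ℂ} (hx : 0 < x.im) : ‖ee x‖ < 1 := by
  rw [norm_ee, Real.exp_lt_one_iff]
  have := mul_pos Real.pi_pos hx
  linarith

lemma ee_add (x y : ℂ) : ee (x + y) = ee x * ee y := by
  rw [ee, mul_add, Complex.exp_add]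
  rfl

lemma ee_natCast_mul (n : ℕ) (x : ℂ) : ee (n * x) = ee x ^ n := by
  rw [ee, ee, ← Complex.exp_nat_mul]
  ring_nf

lemma cot_neg_eq_neg_cot (x : ℂ) : cot (-x) = -cot x := by
  rw [Complex.cot, Complex.cot, Complex.cos_neg, Complex.sin_neg, div_neg]

lemma natCast_mul_im_eq (n : ℕ) (x : ℂ) : (n * x).im = n * x.im := by
  simp

lemma pi_mul_cot_of_im_pos {x : ℂ} (hx : 0 < x.im) :
    π * cot (π * x) = -π * I - 2 * π * I * eeGeom x := by
  have h1 : 1 - ee x ≠ 0 := fun h ↦ by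
    have := norm_ee_lt_one hx
    rw [← sub_eq_zero.mp h] at this
    simp at this
  rw [Complex.cot_pi_eq_exp_ratio, eeGeom]
  change (π : ℂ) * ((ee x + 1) / (I * (1 - ee x))) = _
  have hI := Complex.I_ne_zero
  field_simp
  rw [Complex.I_sq]
  ring

lemma pi_mul_cot_of_im_neg {x : ℂ} (hx : x.im < 0) :
    π * cot (π * x) = π * I + 2 * π * I * eeGeom (-x) := by
  have := pi_mul_cot_of_im_pos (x := -x) (by simpa)
  rw [mul_neg, cot_neg_eq_neg_cot] at this
  linear_combination -this

lemma tsum_pnat_ee_mul {x : ℂ} (hx : 0 < x.im) : ∑' l : ℕ+, ee (l * x) = eeGeom x := by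
  simp_rw [ee_natCast_mul]
  rw [tsum_pnat_eq_tsum_succ (f := fun n : ℕ ↦ ee x ^ n)]
  simp_rw [_root_.pow_succ']
  rw [tsum_mul_left, tsum_geometric_of_norm_lt_one (norm_ee_lt_one hx), eeGeom, div_eq_mul_inv]

lemma summable_pnat_eeGeom {z c : ℂ} (hz : 0 < z.im) (hc : 0 < (c + z).im) :
    Summable fun n : ℕ+ ↦ eeGeom (c + n * z) := by
  have hρ := norm_ee_lt_one hc
  have hg : Summable fun n : ℕ+ ↦ ‖ee c‖ * ‖ee z‖ ^ (n : ℕ) / (1 - ‖ee (c + z)‖) :=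
    (((summable_geometric_of_lt_one (norm_nonneg _) (norm_ee_lt_one hz)).mul_left _).div_const
      _).comp_injective PNat.coe_injective
  refine hg.of_norm_bounded fun n ↦ ?_
  have h1 : ‖ee (c + n * z)‖ ≤ ‖ee (c + z)‖ := by
    rw [norm_ee, norm_ee, Real.exp_le_exp]
    have hn : (1 : ℝ) ≤ (n : ℕ) := by exact_mod_cast n.pos
    have : z.im ≤ (n : ℕ) * z.im := le_mul_of_one_le_left hz.le hn
    simp only [Complex.add_im, natCast_mul_im_eq]
    nlinarith [Real.pi_pos]
  have h2 : 1 - ‖ee (c + z)‖ ≤ ‖1 - ee (c + n * z)‖ := by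
    have := norm_sub_norm_le 1 (ee (c + n * z))
    rw [norm_one] at this
    linarith
  rw [eeGeom, norm_div, ee_add, norm_mul, ee_natCast_mul, norm_pow, ← ee_natCast_mul, ← ee_add]
  have : 0 < 1 - ‖ee (c + z)‖ := by linarith
  gcongr

lemma tsum_one_div_add_sq {y : ℂ} (hy : 0 < y.im) :
    ∑' m : ℤ, 1 / (y + m) ^ 2 = -4 * π ^ 2 * ∑' l : ℕ+, (l : ℂ) ^ 1 * ee y ^ (l : ℕ) := by
  have := EisensteinSeries.qExpansion_identity_pnat (k := 1) le_rfl ⟨y, hy⟩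
  refine this.trans ?_
  congr 1
  simp only [Nat.factorial, Nat.cast_one, mul_pow, Complex.I_sq, Nat.reduceAdd, mul_one, div_one]
  ring

lemma tsum_one_div_neg_add_sq (y : ℂ) :
    ∑' m : ℤ, 1 / (-y + m) ^ 2 = ∑' m : ℤ, 1 / (y + m) ^ 2 := by
  rw [← (Equiv.neg ℤ).tsum_eq]
  refine tsum_congr fun m ↦ ?_
  simp only [Equiv.neg_apply, Int.cast_neg]
  rw [← neg_add, neg_sq]

lemma tsum_tsum_mul_ee_pow {z : ℂ} (hz : 0 < z.im) :
    ∑' n : ℕ+, ∑' l : ℕ+, (l : ℂ) ^ 1 * ee (n * z) ^ (l : ℕ) =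
      ∑' l : ℕ+, (l : ℂ) * ee z ^ (l : ℕ) / (1 - ee z ^ (l : ℕ)) := by
  have h := norm_ee_lt_one hz
  have h1 := tsum_prod_pow_eq_tsum_sigma 1 h
  have h2 := tsum_pow_div_one_sub_eq_tsum_sigma h 1
  simp_rw [ee_natCast_mul, ← pow_mul]
  rw [h1, ← h2]
  simp_rw [pow_one]

lemma summable_tsum_mul_ee_pow {z : ℂ} (hz : 0 < z.im) :
    Summable fun n : ℕ+ ↦ ∑' l : ℕ+, (l : ℂ) ^ 1 * ee (n * z) ^ (l : ℕ) := by
  simp_rw [ee_natCast_mul, ← pow_mul]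
  exact (summable_prod_mul_pow 1 (norm_ee_lt_one hz)).prod

lemma wzetaFn_eq_cot_add {z w : ℂ} (hz : 0 < z.im) (hw : w ∈ Complex.integerComplement)
    (h1 : 0 < (w + z).im) (h2 : 0 < (-w + z).im) :
    wzetaFn z w = π ^ 2 / 3 * E2cl z * w + π * cot (π * w) -
      2 * π * I * (∑' n : ℕ+, eeGeom (w + n * z) - ∑' n : ℕ+, eeGeom (-w + n * z)) := by
  have hs : Summable fun n : ℤ ↦ ∑' m : ℤ, wzetaTerm z w m n := (summable_wzetaTerm hz w).prod
  have hterm (n : ℕ+) : ∑' m : ℤ, wzetaTerm z w m n + ∑' m : ℤ, wzetaTerm z w m (-n) =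
      -8 * π ^ 2 * w * (∑' l : ℕ+, (l : ℂ) ^ 1 * ee (n * z) ^ (l : ℕ)) -
        2 * π * I * (eeGeom (w + n * z) - eeGeom (-w + n * z)) := by
    have hn : (1 : ℝ) ≤ (n : ℕ) := by exact_mod_cast n.pos
    have hnz : z.im ≤ (n : ℕ) * z.im := le_mul_of_one_le_left hz.le hn
    simp only [Complex.add_im, Complex.neg_im] at h1 h2
    have hp : 0 < (w + n * z).im := by
      simp only [Complex.add_im, natCast_mul_im_eq]
      linarith
    have hm : (w - n * z).im < 0 := by
      simp only [Complex.sub_im, natCast_mul_im_eq]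
      linarith
    have hn0 : ((n : ℕ) : ℤ) ≠ 0 := by exact_mod_cast n.ne_zero
    rw [tsum_wzetaTerm_of_ne_zero hz hn0, tsum_wzetaTerm_of_ne_zero hz (neg_ne_zero.mpr hn0)]
    · simp only [Int.cast_neg, Int.cast_natCast, neg_mul, sub_neg_eq_add]
      rw [tsum_one_div_neg_add_sq, tsum_one_div_add_sq (by simpa using hz), mul_neg, cot_neg_eq_neg_cot,
        pi_mul_cot_of_im_pos hp, pi_mul_cot_of_im_neg hm, neg_sub, sub_eq_neg_add]
      ring
    · exact mem_integerComplement_of_im_ne_zero (by simpa using hp.ne')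
    · exact mem_integerComplement_of_im_ne_zero (by simpa using hm.ne)
  have s1 := summable_pnat_eeGeom hz h1
  have s2 := summable_pnat_eeGeom hz h2
  have s3 := summable_tsum_mul_ee_pow hz
  rw [wzetaFn_eq_tsum hz, tsum_int_eq_zero_add_tsum_pnat_add hs, tsum_wzetaTerm_zero hz hw]
  simp_rw [hterm]
  rw [(s3.mul_left _).tsum_sub ((s1.sub s2).mul_left _), tsum_mul_left, tsum_mul_left,
    s1.tsum_sub s2, tsum_tsum_mul_ee_pow hz, E2cl]
  ring

lemma Scal_zero_eq_tsum {z : ℂ} (hz : 0 < z.im) (α β : ℝ) :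
    Scal 0 β 0 0 α (-I * z) =
      ∑' k : {k : ℤ // 0 < β + (k : ℝ)}, eeGeom (α + β * z + (k.1 : ℂ) * z) := by
  refine tsum_congr fun k ↦ ?_
  have him : 0 < (α + β * z + (k.1 : ℂ) * z).im := by
    have := mul_pos k.2 hz
    simpa [add_mul] using this
  rw [← tsum_pnat_ee_mul him]
  let e : ℕ+ ≃ {l : ℤ // 0 < (0 : ℝ) + (l : ℝ)} :=
    { toFun := fun n ↦ ⟨n, by simp⟩
      invFun := fun l ↦ ⟨l.1.toNat, by
        have := l.2
        rw [zero_add, Int.cast_pos] at this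
        omega⟩
      left_inv := fun n ↦ PNat.coe_injective (by simp)
      right_inv := fun l ↦ by
        have := l.2
        rw [zero_add, Int.cast_pos] at this
        ext
        simp [this.le] }
  rw [← e.tsum_eq]
  refine tsum_congr fun n ↦ ?_
  rw [neg_zero, Complex.cpow_zero, mul_one, ee, ee, ← Complex.exp_add]
  congr 1
  rw [show (e n).1 = ((n : ℕ) : ℤ) from rfl]
  push_cast
  ring

lemma Scal_zero_of_nonpos {z : ℂ} (hz : 0 < z.im) (α : ℝ) {β : ℝ} (h : -1 < β) (h' : β ≤ 0) :
    Scal 0 β 0 0 α (-I * z) = ∑' n : ℕ+, eeGeom (α + β * z + n * z) := by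
  rw [Scal_zero_eq_tsum hz]
  have hk (k : {k : ℤ // 0 < β + (k : ℝ)}) : 0 < k.1 := by
    have : (0 : ℝ) < k.1 := by linarith [k.2]
    exact_mod_cast this
  let e : ℕ+ ≃ {k : ℤ // 0 < β + (k : ℝ)} :=
    { toFun := fun n ↦ ⟨n, by
        have hn : (1 : ℝ) ≤ (n : ℕ) := by exact_mod_cast n.pos
        push_cast
        linarith⟩
      invFun := fun l ↦ ⟨l.1.toNat, by have := hk l; omega⟩
      left_inv := fun n ↦ PNat.coe_injective (by simp)
      right_inv := fun l ↦ by
        ext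
        simp [(hk l).le] }
  rw [← e.tsum_eq]
  refine tsum_congr fun n ↦ ?_
  rw [show (e n).1 = ((n : ℕ) : ℤ) from rfl, Int.cast_natCast]

lemma Scal_zero_of_pos {z : ℂ} (hz : 0 < z.im) (α : ℝ) {β : ℝ} (h : 0 < β) (h' : β < 1) :
    Scal 0 β 0 0 α (-I * z) =
      eeGeom (α + β * z) + ∑' n : ℕ+, eeGeom (α + β * z + n * z) := by
  rw [Scal_zero_eq_tsum hz]
  have hk (k : {k : ℤ // 0 < β + (k : ℝ)}) : 0 ≤ k.1 := by
    have : (-1 : ℝ) < k.1 := by linarith [k.2]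
    have : -1 < k.1 := by exact_mod_cast this
    omega
  let e : ℕ ≃ {k : ℤ // 0 < β + (k : ℝ)} :=
    { toFun := fun n ↦ ⟨n, by push_cast; positivity⟩
      invFun := fun l ↦ l.1.toNat
      left_inv := fun n ↦ by simp
      right_inv := fun l ↦ by
        ext
        simp [hk l] }
  have hs : Summable fun n : ℕ ↦ eeGeom (α + β * z + n * z) := by
    rw [← summable_pnat_iff_summable_nat (f := fun n : ℕ ↦ eeGeom (α + β * z + n * z))]
    refine summable_pnat_eeGeom hz ?_
    have := mul_pos h hz
    simp
    linarith
  rw [← e.tsum_eq]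
  have := tsum_zero_pnat_eq_tsum_nat hs
  simp only [Nat.cast_zero, zero_mul, add_zero] at this
  rw [this]
  simp [e]

/-- Corollary 4.8 of the paper: the `q`-expansion of Weierstrass' zeta function. -/
theorem statement13 (z : ℂ) (hz : 0 < z.im) (α β : ℝ)
    (hα : -1 < α) (hα' : α < 1) (hβ : -1 < β) (hβ' : β < 1) (hne : ¬(α = 0 ∧ β = 0)) :
    wzetaFn z ((α : ℂ) + (β : ℂ) * z) =
      ((Real.pi : ℂ) ^ 2 / 3) * E2cl z * ((α : ℂ) + (β : ℂ) * z) +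
        (if β = 0 then 1 else 0) * (Real.pi : ℂ) *
          (Complex.cos ((Real.pi : ℂ) * (α : ℂ)) / Complex.sin ((Real.pi : ℂ) * (α : ℂ))) -
        ((Real.sign β : ℝ) : ℂ) * (Real.pi : ℂ) * Complex.I -
        2 * (Real.pi : ℂ) * Complex.I *
          (Scal 0 β 0 0 α (-Complex.I * z) - Scal 0 (-β) 0 0 (-α) (-Complex.I * z)) := by
  set w : ℂ := (α : ℂ) + (β : ℂ) * z with hw_def
  have him : w.im = β * z.im := by simp [w]
  have hneg : ((-α : ℝ) : ℂ) + ((-β : ℝ) : ℂ) * z = -w := by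
    rw [hw_def]
    push_cast
    ring
  have hw : w ∈ Complex.integerComplement := by
    rcases eq_or_ne β 0 with rfl | hβ0
    · rintro ⟨n, hn⟩
      have hn' : (n : ℝ) = α := by
        have : (n : ℂ) = (α : ℂ) := by simpa [w] using hn
        exact_mod_cast this
      have h1 : -1 < n := by
        rw [← hn'] at hα
        exact_mod_cast hα
      have h2 : n < 1 := by
        rw [← hn'] at hα'
        exact_mod_cast hα'
      obtain rfl : n = 0 := by omega
      exact hne ⟨by simpa using hn'.symm, rfl⟩
    · exact mem_integerComplement_of_im_ne_zero (by simp [him, hβ0, hz.ne'])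
  have h1 : 0 < (w + z).im := by
    rw [Complex.add_im, him]
    nlinarith
  have h2 : 0 < (-w + z).im := by
    rw [Complex.add_im, Complex.neg_im, him]
    nlinarith
  rw [wzetaFn_eq_cot_add hz hw h1 h2]
  rcases lt_trichotomy β 0 with hlt | rfl | hgt
  · have e1 := Scal_zero_of_nonpos hz α hβ hlt.le
    have e2 := Scal_zero_of_pos hz (-α) (β := -β) (by linarith) (by linarith)
    rw [hneg] at e2
    rw [e1, e2, pi_mul_cot_of_im_neg (by rw [him]; exact mul_neg_of_neg_of_pos hlt hz),
      Real.sign_of_neg hlt, if_neg hlt.ne]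
    push_cast
    ring
  · have e1 := Scal_zero_of_nonpos hz α (β := 0) (by norm_num) le_rfl
    have e2 := Scal_zero_of_nonpos hz (-α) (β := -0) (by norm_num) (by norm_num)
    rw [hneg] at e2
    have hwα : w = α := by simp [w]
    rw [e1, e2, ← hw_def, ← hwα, Real.sign_zero, if_pos rfl, Complex.cot]
    push_cast
    ring
  · have e1 := Scal_zero_of_pos hz α hgt hβ'
    have e2 := Scal_zero_of_nonpos hz (-α) (β := -β) (by linarith) (by linarith)
    rw [hneg] at e2
    rw [e1, e2, pi_mul_cot_of_im_pos (by rw [him]; exact mul_pos hgt hz),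
      Real.sign_of_pos hgt, if_neg hgt.ne']
    push_cast
    ring

end
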